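/- Let D be a division ring whose center k is uncountable. If D contains a free k-algebra of rank 2 (there is an injective k-algebra homomorphism FreeAlgebra k (Fin 2) → D), then D contains the k-group algebra of the free group of rank 2 (there is an injective k-algebra homomorphism MonoidAlgebra k (FreeGroup (Fin 2)) → D). -/

import Mathlib

theorem eq_zero_of_sum_range_one_add_pow_mul_eq_zero {R : Type*} [Ring R] {X : R}
    {Q : AddSubgroup R} (hQ : ∀ q ∈ Q, ∀ r, q + X * r = 0 → q = 0 ∧ r = 0) (m : ℕ) (q : ℕ → R)
    (hq : ∀ i, q i ∈ Q) (h : ∑ i ∈ Finset.range m, (1 + X) ^ i * q i = 0) :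
    ∀ i < m, q i = 0 := by
  have key : ∀ (m : ℕ) (q : ℕ → R), ∑ i ∈ Finset.range (m + 1), (1 + X) ^ i * q i =
      ∑ i ∈ Finset.range (m + 1), q i +
        X * ∑ j ∈ Finset.range m, (1 + X) ^ j * ∑ i ∈ Finset.Ico (j + 1) (m + 1), q i := by
    intro m q
    induction m with
    | zero => simp
    | succ m ih =>
      rw [Finset.sum_range_succ, ih, Finset.sum_range_succ _ (m + 1),
        Finset.sum_range_succ (fun j => (1 + X) ^ j * ∑ i ∈ Finset.Ico (j + 1) (m + 1 + 1), q i) m]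
      have h1 : ∀ j ∈ Finset.range m, (1 + X) ^ j * ∑ i ∈ Finset.Ico (j + 1) (m + 1 + 1), q i =
          (1 + X) ^ j * ∑ i ∈ Finset.Ico (j + 1) (m + 1), q i + (1 + X) ^ j * q (m + 1) := by
        intro j hj
        rw [Finset.sum_Ico_succ_top (by simp at hj; omega), mul_add]
      rw [Finset.sum_congr rfl h1, Finset.sum_add_distrib, ← Finset.sum_mul]
      have h2 := mul_geom_sum (1 + X) (m + 1)
      rw [add_sub_cancel_left, Finset.sum_range_succ] at h2
      rw [eq_add_of_sub_eq h2.symm]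
      simp
      noncomm_ring
  induction m generalizing q with
  | zero => intro i hi; omega
  | succ m ih =>
    rw [key] at h
    obtain ⟨h0, h1⟩ := hQ _ (sum_mem fun i _ => hq i) _ h
    have h2 := ih _ (fun j => sum_mem fun i _ => hq i) h1
    have h3 : ∀ j ≤ m + 1, ∑ i ∈ Finset.Ico j (m + 1), q i = 0 := by
      intro j hj
      rcases j with _ | j
      · simpa using h0
      · rcases (Nat.le_of_succ_le_succ hj).lt_or_eq with hj | rfl
        · exact h2 j hj
        · simp
    intro i hi
    have h4 := h3 i hi.le
    rwa [Finset.sum_eq_sum_Ico_succ_bot hi, h3 (i + 1) hi, add_zero] at h4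

theorem eq_zero_of_sum_zpow_mul_eq_zero {R : Type*} [Ring R] {X : R} {Q : AddSubgroup R}
    (hQ : ∀ q ∈ Q, ∀ r, q + X * r = 0 → q = 0 ∧ r = 0) {u : Rˣ} (hu : (u : R) = 1 + X)
    (s : Finset ℤ) (q : ℤ → R) (hq : ∀ e, q e ∈ Q)
    (h : ∑ e ∈ s, ((u ^ e : Rˣ) : R) * q e = 0) : ∀ e ∈ s, q e = 0 := by
  classical
  set N : ℕ := s.sup Int.natAbs with hN
  have hle : ∀ e ∈ s, e.natAbs ≤ N := fun e he => Finset.le_sup he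
  have h0 := eq_zero_of_sum_range_one_add_pow_mul_eq_zero hQ (2 * N + 1)
    (fun i => if (i : ℤ) - N ∈ s then q (i - N) else 0)
    (by intro i; split_ifs; exacts [hq _, zero_mem _]) ?_
  · intro e he
    have h1 := h0 (e + N).toNat (by have := hle e he; omega)
    have h2 : (((e + N).toNat : ℕ) : ℤ) - N = e := by have := hle e he; omega
    rwa [h2, if_pos he] at h1
  · have h1 : ((u ^ N : Rˣ) : R) * ∑ e ∈ s, ((u ^ e : Rˣ) : R) * q e = 0 := by rw [h, mul_zero]
    rw [Finset.mul_sum] at h1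
    refine Eq.trans ?_ h1
    simp only [mul_ite, mul_zero, ← hu]
    rw [← Finset.sum_filter]
    refine Finset.sum_bij' (fun i _ => (i : ℤ) - N) (fun e _ => (e + N).toNat) ?_ ?_ ?_ ?_ ?_
    · intro i hi
      exact (Finset.mem_filter.1 hi).2
    · intro e he
      have := hle e he
      have h2 : (((e + N).toNat : ℕ) : ℤ) - N = e := by omega
      simp only [Finset.mem_filter, Finset.mem_range, h2]
      exact ⟨by omega, he⟩
    · intro i hi
      simp
    · intro e he
      have := hle e he
      omega
    · intro i hi
      rw [← mul_assoc, ← Units.val_mul, ← Units.val_pow_eq_pow_val]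
      congr 2
      rw [← zpow_natCast, ← zpow_natCast, ← zpow_add]
      congr 1
      ring

theorem FreeGroup.induction_of_mul {α : Type*} {p : FreeGroup α → Prop} (one : p 1)
    (of_mul : ∀ a g, p g → p (FreeGroup.of a * g))
    (inv_of_mul : ∀ a g, p g → p ((FreeGroup.of a)⁻¹ * g)) (g : FreeGroup α) : p g := by
  suffices ∀ h, p h → p (g * h) by simpa using this 1 one
  induction g using FreeGroup.induction_on with
  | C1 => simp
  | of a => exact fun h hh => of_mul a h hh
  | inv_of a _ => exact fun h hh => inv_of_mul a h hh
  | mul g₁ g₂ h₁ h₂ => exact fun h hh => by simpa [mul_assoc] using h₁ _ (h₂ h hh)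

/-- Combinations of alternating products of elements `x b ^ e - 1`, at most `n` factors long and
starting with the letter `b`. -/
def alternatingSpan (C : Type*) {B : Type*} [CommRing C] [Ring B] [Algebra C B] (x : Fin 2 → Bˣ) :
    ℕ → Fin 2 → Submodule C B
  | 0, _ => ⊥
  | n + 1, b => ⨆ e : ℤ, (1 ⊔ alternatingSpan C x n (b + 1)).map
      (LinearMap.mulLeft C (((x b ^ e : Bˣ) : B) - 1))

section

variable {C B R : Type*} [CommRing C] [Ring B] [Algebra C B] [Ring R] [Algebra C R]
  {x : Fin 2 → Bˣ} {X : Fin 2 → R} {Φ : B →ₐ[C] R}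

theorem exists_zpow_sub_one_eq_mul {R : Type*} [Ring R] {X : R} {u : Rˣ} (hu : (u : R) = 1 + X)
    (e : ℤ) : ∃ r, ((u ^ e : Rˣ) : R) - 1 = X * r := by
  induction e with
  | zero => exact ⟨0, by simp⟩
  | succ n ih =>
    obtain ⟨r, hr⟩ := ih
    refine ⟨r + ((u ^ (n : ℤ) : Rˣ) : R), ?_⟩
    rw [mul_add, ← hr, add_comm, zpow_add, zpow_one, Units.val_mul, hu]
    noncomm_ring
  | pred n ih =>
    obtain ⟨r, hr⟩ := ih
    refine ⟨r - ((u ^ (-(n : ℤ) - 1) : Rˣ) : R), ?_⟩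
    have h : ((u ^ (-(n : ℤ)) : Rˣ) : R) = (1 + X) * ((u ^ (-(n : ℤ) - 1) : Rˣ) : R) := by
      rw [← hu, ← Units.val_mul, ← zpow_one_add]
      congr 2
      ring
    rw [mul_sub, ← hr, h]
    noncomm_ring

theorem exists_eq_mul_of_mem_alternatingSpan (hx : ∀ b, Φ (x b) = 1 + X b) {n : ℕ} {b : Fin 2}
    {f : B} (hf : f ∈ alternatingSpan C x n b) : ∃ r, Φ f = X b * r := by
  cases n with
  | zero =>
    rw [alternatingSpan, Submodule.mem_bot] at hf
    exact ⟨0, by simp [hf]⟩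
  | succ n =>
    rw [alternatingSpan] at hf
    refine Submodule.iSup_induction _ (motive := fun f => ∃ r, Φ f = X b * r) hf ?_ ?_ ?_
    · rintro e _ ⟨q, -, rfl⟩
      obtain ⟨r, hr⟩ := exists_zpow_sub_one_eq_mul
        (u := Units.map (Φ : B →* R) (x b)) (X := X b) (by simp [hx]) e
      refine ⟨r * Φ q, ?_⟩
      rw [← mul_assoc, ← hr, ← map_zpow]
      simp only [LinearMap.mulLeft_apply, map_mul, map_sub, map_one, Units.coe_map,
        MonoidHom.coe_coe]
    · exact ⟨0, by simp⟩
    · rintro f g ⟨r, hr⟩ ⟨s, hs⟩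
      exact ⟨r + s, by rw [map_add, hr, hs, mul_add]⟩

theorem exists_sum_of_mem_alternatingSpan {n : ℕ} {b : Fin 2} {f : B}
    (hf : f ∈ alternatingSpan C x (n + 1) b) :
    ∃ (s : Finset ℤ) (q : ℤ → B), (∀ e, q e ∈ 1 ⊔ alternatingSpan C x n (b + 1)) ∧
      f = ∑ e ∈ s, (((x b ^ e : Bˣ) : B) - 1) * q e := by
  rw [alternatingSpan, Submodule.mem_iSup_iff_exists_finsupp] at hf
  obtain ⟨g, hg, rfl⟩ := hf
  choose q hq hqg using hg
  exact ⟨g.support, q, hq, Finset.sum_congr rfl fun e _ => (hqg e).symm⟩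

theorem eq_zero_of_mem_alternatingSpan (hx : ∀ b, Φ (x b) = 1 + X b)
    (hX : ∀ b (c : C) (r s : R), algebraMap C R c + X b * r + X (b + 1) * s = 0 →
      c = 0 ∧ r = 0 ∧ s = 0) {n : ℕ} {b : Fin 2}
    {f : B} (hf : f ∈ alternatingSpan C x n b) (h : Φ f = 0) : f = 0 := by
  classical
  induction n generalizing b f with
  | zero => simpa [alternatingSpan] using hf
  | succ n ih =>
    have split : ∀ q ∈ (1 ⊔ alternatingSpan C x n (b + 1) : Submodule C B),
        ∃ c r, Φ q = algebraMap C R c + X (b + 1) * r ∧ (Φ q = 0 → q = 0) := by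
      intro q hq
      obtain ⟨v, hv, w, hw, rfl⟩ := Submodule.mem_sup.1 hq
      obtain ⟨c, rfl⟩ := Submodule.mem_one.1 hv
      obtain ⟨r, hr⟩ := exists_eq_mul_of_mem_alternatingSpan hx hw
      have h1 : Φ (algebraMap C B c + w) = algebraMap C R c + X (b + 1) * r := by
        rw [map_add, hr, AlgHom.commutes]
      refine ⟨c, r, h1, fun h2 => ?_⟩
      obtain ⟨rfl, -, rfl⟩ := hX b c 0 r (by rw [mul_zero, add_zero, ← h1, h2])
      rw [ih hw (by simpa using hr)]
      simp
    let Q : AddSubgroup R :=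
      { carrier := {q | ∃ (c : C) (r : R), q = algebraMap C R c + X (b + 1) * r}
        zero_mem' := ⟨0, 0, by simp⟩
        add_mem' := by
          rintro _ _ ⟨c, r, rfl⟩ ⟨d, s, rfl⟩
          exact ⟨c + d, r + s, by rw [map_add]; noncomm_ring⟩
        neg_mem' := by
          rintro _ ⟨c, r, rfl⟩
          exact ⟨-c, -r, by rw [map_neg]; noncomm_ring⟩ }
    have hQ : ∀ q ∈ Q, ∀ r, q + X b * r = 0 → q = 0 ∧ r = 0 := by
      rintro _ ⟨c, s, rfl⟩ r h
      obtain ⟨rfl, rfl, rfl⟩ := hX b c r s (by rw [← h]; abel)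
      simp
    obtain ⟨s, q, hq, rfl⟩ := exists_sum_of_mem_alternatingSpan hf
    have hqQ : ∀ e, Φ (q e) ∈ Q := fun e => by
      obtain ⟨c, r, h, -⟩ := split _ (hq e)
      exact ⟨c, r, h⟩
    have h0 := eq_zero_of_sum_zpow_mul_eq_zero hQ
      (u := Units.map (Φ : B →* R) (x b)) (by simp [hx]) (insert 0 s)
      (fun e => (if e ∈ s then Φ (q e) else 0) - if e = 0 then ∑ e ∈ s, Φ (q e) else 0)
      (by
        intro e
        refine sub_mem ?_ ?_
        · split_ifs
          exacts [hqQ e, zero_mem _]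
        · split_ifs
          exacts [sum_mem fun e _ => hqQ e, zero_mem _])
      (by
        refine Eq.trans ?_ h
        have h1 : ∑ e ∈ s, Φ ((((x b ^ e : Bˣ) : B) - 1) * q e) =
            ∑ e ∈ s, Φ ((x b ^ e : Bˣ) : B) * Φ (q e) - ∑ e ∈ s, Φ (q e) := by
          simp only [map_mul, sub_mul, map_sub, one_mul, Finset.sum_sub_distrib]
        rw [map_sum, h1]
        simp only [mul_sub, Finset.sum_sub_distrib]
        congr 1
        · simp only [mul_ite, mul_zero]
          rw [← Finset.sum_filter, Finset.filter_mem_eq_inter,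
            Finset.inter_eq_right.2 (Finset.subset_insert _ _)]
          refine Finset.sum_congr rfl fun e _ => ?_
          rw [← map_zpow, Units.coe_map, MonoidHom.coe_coe]
        · simp)
    refine Finset.sum_eq_zero fun e he => ?_
    by_cases h1 : e = 0
    · simp [h1]
    · have h2 := h0 e (Finset.mem_insert_of_mem he)
      simp only [he, h1, if_true, if_false, sub_zero] at h2
      obtain ⟨-, -, -, h3⟩ := split _ (hq e)
      rw [h3 h2, mul_zero]

theorem alternatingSpan_le_succ (n : ℕ) (b : Fin 2) :
    alternatingSpan C x n b ≤ alternatingSpan C x (n + 1) b := by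
  induction n generalizing b with
  | zero => exact bot_le
  | succ n ih =>
    rw [alternatingSpan, alternatingSpan]
    exact iSup_mono fun e => Submodule.map_mono (sup_le_sup_left (ih _) _)

theorem zpow_sub_one_mul_mem_alternatingSpan {n : ℕ} {b : Fin 2} {q : B} (e : ℤ)
    (hq : q ∈ 1 ⊔ alternatingSpan C x n (b + 1)) :
    (((x b ^ e : Bˣ) : B) - 1) * q ∈ alternatingSpan C x (n + 1) b := by
  rw [alternatingSpan]
  exact Submodule.mem_iSup_of_mem e ⟨q, hq, rfl⟩

theorem zpow_mul_mem_alternatingSpan {n : ℕ} {b : Fin 2} {f : B} (e : ℤ)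
    (hf : f ∈ 1 ⊔ alternatingSpan C x n b ⊔ alternatingSpan C x n (b + 1)) :
    ((x b ^ e : Bˣ) : B) * f ∈
      1 ⊔ alternatingSpan C x (n + 1) b ⊔ alternatingSpan C x (n + 1) (b + 1) := by
  have hmono : 1 ⊔ alternatingSpan C x n (b + 1) ≤
      1 ⊔ alternatingSpan C x (n + 1) b ⊔ alternatingSpan C x (n + 1) (b + 1) :=
    sup_le (le_sup_of_le_left le_sup_left)
      ((alternatingSpan_le_succ n (b + 1)).trans le_sup_right)
  have hb : alternatingSpan C x (n + 1) b ≤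
      1 ⊔ alternatingSpan C x (n + 1) b ⊔ alternatingSpan C x (n + 1) (b + 1) :=
    le_sup_of_le_left le_sup_right
  rw [sup_right_comm] at hf
  obtain ⟨q, hq, w, hw, rfl⟩ := Submodule.mem_sup.1 hf
  rw [mul_add]
  refine add_mem ?_ (hb ?_)
  · have h1 : ((x b ^ e : Bˣ) : B) * q = q + (((x b ^ e : Bˣ) : B) - 1) * q := by noncomm_ring
    rw [h1]
    exact add_mem (hmono hq) (hb (zpow_sub_one_mul_mem_alternatingSpan e hq))
  · cases n with
    | zero =>
      rw [alternatingSpan, Submodule.mem_bot] at hw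
      simp [hw]
    | succ n =>
      obtain ⟨s, q, hq, rfl⟩ := exists_sum_of_mem_alternatingSpan hw
      rw [Finset.mul_sum]
      refine sum_mem fun i _ => alternatingSpan_le_succ _ _ ?_
      have h1 : ((x b ^ e : Bˣ) : B) * ((((x b ^ i : Bˣ) : B) - 1) * q i) =
          (((x b ^ (e + i) : Bˣ) : B) - 1) * q i - (((x b ^ e : Bˣ) : B) - 1) * q i := by
        rw [zpow_add, Units.val_mul]
        noncomm_ring
      rw [h1]
      exact sub_mem (zpow_sub_one_mul_mem_alternatingSpan _ (hq i))
        (zpow_sub_one_mul_mem_alternatingSpan _ (hq i))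

theorem zpow_mul_mem_alternatingSpan' {n : ℕ} (b : Fin 2) {f : B} (e : ℤ)
    (hf : f ∈ 1 ⊔ alternatingSpan C x n 0 ⊔ alternatingSpan C x n 1) :
    ((x b ^ e : Bˣ) : B) * f ∈
      1 ⊔ alternatingSpan C x (n + 1) 0 ⊔ alternatingSpan C x (n + 1) 1 := by
  have h : ∀ n, 1 ⊔ alternatingSpan C x n 0 ⊔ alternatingSpan C x n 1 =
      1 ⊔ alternatingSpan C x n b ⊔ alternatingSpan C x n (b + 1) := by
    intro n
    fin_cases b
    · rfl
    · exact sup_right_comm _ _ _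
  rw [h] at hf ⊢
  exact zpow_mul_mem_alternatingSpan e hf

theorem exists_lift_mem_alternatingSpan (g : FreeGroup (Fin 2)) :
    ∃ n, ((FreeGroup.lift x g : Bˣ) : B) ∈
      1 ⊔ alternatingSpan C x n 0 ⊔ alternatingSpan C x n 1 := by
  induction g using FreeGroup.induction_of_mul with
  | one =>
    refine ⟨0, ?_⟩
    rw [map_one, Units.val_one]
    exact (le_sup_of_le_left le_sup_left : (1 : Submodule C B) ≤ _)
      (Submodule.mem_one.2 ⟨1, map_one _⟩)
  | of_mul b g ih =>
    obtain ⟨n, hn⟩ := ih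
    refine ⟨n + 1, ?_⟩
    rw [map_mul, FreeGroup.lift_apply_of, Units.val_mul, ← zpow_one (x b)]
    exact zpow_mul_mem_alternatingSpan' b 1 hn
  | inv_of_mul b g ih =>
    obtain ⟨n, hn⟩ := ih
    refine ⟨n + 1, ?_⟩
    rw [map_mul, map_inv, FreeGroup.lift_apply_of, Units.val_mul, ← zpow_neg_one (x b)]
    exact zpow_mul_mem_alternatingSpan' b (-1) hn

theorem eq_zero_of_mem_alternatingSpan' (hx : ∀ b, Φ (x b) = 1 + X b)
    (hX : ∀ b (c : C) (r s : R), algebraMap C R c + X b * r + X (b + 1) * s = 0 →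
      c = 0 ∧ r = 0 ∧ s = 0) {n : ℕ} {f : B}
    (hf : f ∈ 1 ⊔ alternatingSpan C x n 0 ⊔ alternatingSpan C x n 1) (h : Φ f = 0) : f = 0 := by
  obtain ⟨v', hv', w₁, hw₁, rfl⟩ := Submodule.mem_sup.1 hf
  obtain ⟨v, hv, w₀, hw₀, rfl⟩ := Submodule.mem_sup.1 hv'
  obtain ⟨c, rfl⟩ := Submodule.mem_one.1 hv
  obtain ⟨r, hr⟩ := exists_eq_mul_of_mem_alternatingSpan hx hw₀
  obtain ⟨s, hs⟩ := exists_eq_mul_of_mem_alternatingSpan hx hw₁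
  rw [map_add, map_add, AlgHom.commutes, hr, hs] at h
  obtain ⟨rfl, rfl, rfl⟩ := hX 0 c r s h
  rw [eq_zero_of_mem_alternatingSpan hx hX hw₀ (by simpa using hr),
    eq_zero_of_mem_alternatingSpan hx hX hw₁ (by simpa using hs)]
  simp

end

/-- Magnus's theorem for group algebras. -/
theorem injective_lift_freeGroup_of_one_add {C R : Type*} [CommRing C] [Ring R] [Algebra C R]
    {X : Fin 2 → R} {u : Fin 2 → Rˣ} (hu : ∀ b, (u b : R) = 1 + X b)
    (hX : ∀ b (c : C) (r s : R), algebraMap C R c + X b * r + X (b + 1) * s = 0 →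
      c = 0 ∧ r = 0 ∧ s = 0) :
    Function.Injective (MonoidAlgebra.lift C R (FreeGroup (Fin 2))
      ((Units.coeHom R).comp (FreeGroup.lift u))) := by
  set Φ := MonoidAlgebra.lift C R (FreeGroup (Fin 2)) ((Units.coeHom R).comp (FreeGroup.lift u))
  let x : Fin 2 → (MonoidAlgebra C (FreeGroup (Fin 2)))ˣ := fun b =>
    Units.map (MonoidAlgebra.of C (FreeGroup (Fin 2))) (toUnits (FreeGroup.of b))
  have hlift : ∀ g, ((FreeGroup.lift x g : (MonoidAlgebra C (FreeGroup (Fin 2)))ˣ) :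
      MonoidAlgebra C (FreeGroup (Fin 2))) = MonoidAlgebra.of C _ g := by
    intro g
    have h : FreeGroup.lift x = (Units.map (MonoidAlgebra.of C (FreeGroup (Fin 2)))).comp
        (toUnits (G := FreeGroup (Fin 2))).toMonoidHom := by
      ext b
      simp [x]
    rw [h]
    simp
  have hx : ∀ b, Φ (x b) = 1 + X b := by
    intro b
    simp [Φ, x, hu]
  rw [injective_iff_map_eq_zero]
  intro f hf
  obtain ⟨n, hn⟩ : ∃ n, f ∈ 1 ⊔ alternatingSpan C x n 0 ⊔ alternatingSpan C x n 1 := by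
    have hmono : Monotone fun n => 1 ⊔ alternatingSpan C x n 0 ⊔ alternatingSpan C x n 1 :=
      monotone_nat_of_le_succ fun n => sup_le_sup
        (sup_le_sup_left (alternatingSpan_le_succ n 0) _) (alternatingSpan_le_succ n 1)
    clear hf
    induction f using MonoidAlgebra.induction_on with
    | of g =>
      obtain ⟨n, hn⟩ := exists_lift_mem_alternatingSpan (C := C) (x := x) g
      exact ⟨n, hlift g ▸ hn⟩
    | add f g ihf ihg =>
      obtain ⟨m, hm⟩ := ihf
      obtain ⟨n, hn⟩ := ihg
      exact ⟨max m n, add_mem (hmono (le_max_left _ _) hm) (hmono (le_max_right _ _) hn)⟩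
    | smul c f ih =>
      obtain ⟨n, hn⟩ := ih
      exact ⟨n, Submodule.smul_mem _ _ hn⟩
  exact eq_zero_of_mem_alternatingSpan' hx hX hn hf

theorem FreeMonoid.algebraMap_add_of_mul_add_of_mul_eq_zero {K : Type*} [CommRing K] (b : Fin 2)
    (c : K) (r s : MonoidAlgebra K (FreeMonoid (Fin 2)))
    (h : algebraMap K _ c + MonoidAlgebra.of K _ (FreeMonoid.of b) * r +
      MonoidAlgebra.of K _ (FreeMonoid.of (b + 1)) * s = 0) : c = 0 ∧ r = 0 ∧ s = 0 := by
  have hb : b + 1 ≠ b := by fin_cases b <;> simp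
  have hne : ∀ (a : Fin 2) (w : FreeMonoid (Fin 2)), FreeMonoid.of a * w ≠ 1 := by
    intro a w h
    simpa using congrArg FreeMonoid.length h
  have hoff : ∀ (a a' : Fin 2), a ≠ a' → ∀ w : FreeMonoid (Fin 2),
      ∀ d, FreeMonoid.of a * d ≠ FreeMonoid.of a' * w := by
    intro a a' haa w d hd
    have := congrArg FreeMonoid.toList hd
    simp only [FreeMonoid.toList_of_mul, List.cons.injEq] at this
    exact haa this.1
  have hself : ∀ (a : Fin 2) (w : FreeMonoid (Fin 2)) (r : MonoidAlgebra K (FreeMonoid (Fin 2))),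
      (MonoidAlgebra.of K _ (FreeMonoid.of a) * r).coeff (FreeMonoid.of a * w) = r.coeff w := by
    intro a w r
    rw [MonoidAlgebra.of_apply, MonoidAlgebra.coeff_single_mul_eq_mul_coeff, one_mul]
    intro d _
    exact mul_left_cancel_iff
  have hother : ∀ (a a' : Fin 2), a ≠ a' → ∀ (w : FreeMonoid (Fin 2))
      (r : MonoidAlgebra K (FreeMonoid (Fin 2))),
      (MonoidAlgebra.of K _ (FreeMonoid.of a) * r).coeff (FreeMonoid.of a' * w) = 0 := by
    intro a a' haa w r
    exact MonoidAlgebra.coeff_single_mul_of_forall_mul_ne _ _ (hoff a a' haa w)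
  have hone : ∀ (a : Fin 2) (r : MonoidAlgebra K (FreeMonoid (Fin 2))),
      (MonoidAlgebra.of K _ (FreeMonoid.of a) * r).coeff 1 = 0 := by
    intro a r
    exact MonoidAlgebra.coeff_single_mul_of_forall_mul_ne _ _ (hne a)
  have hcoeff : ∀ w, (algebraMap K (MonoidAlgebra K (FreeMonoid (Fin 2))) c).coeff w +
      (MonoidAlgebra.of K _ (FreeMonoid.of b) * r).coeff w +
      (MonoidAlgebra.of K _ (FreeMonoid.of (b + 1)) * s).coeff w = 0 := by
    intro w
    have := congrArg (fun f => MonoidAlgebra.coeff f w) h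
    simpa using this
  have hc : c = 0 := by
    have := hcoeff 1
    rw [hone, hone] at this
    simpa using this
  subst hc
  refine ⟨rfl, ?_, ?_⟩
  · ext w
    have := hcoeff (FreeMonoid.of b * w)
    rw [hself, hother _ _ hb] at this
    simpa using this
  · ext w
    have := hcoeff (FreeMonoid.of (b + 1) * w)
    rw [hself, hother _ _ hb.symm] at this
    simpa using this

/-- The inclusion of `K[X]` in the power series over a `K`-algebra. -/
noncomputable def polynomialToPowerSeries (K A : Type*) [CommRing K] [Ring A] [Algebra K A] :
    Polynomial K →+* PowerSeries A :=
  (PowerSeries.map (algebraMap K A)).comp Polynomial.coeToPowerSeries.ringHom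

theorem coeff_polynomialToPowerSeries {K A : Type*} [CommRing K] [Ring A] [Algebra K A]
    (c : Polynomial K) (n : ℕ) :
    PowerSeries.coeff n (polynomialToPowerSeries K A c) = algebraMap K A (c.coeff n) := by
  simp [polynomialToPowerSeries]

theorem polynomialToPowerSeries_commutes {K A : Type*} [CommRing K] [Ring A] [Algebra K A]
    (c : Polynomial K) (f : PowerSeries A) :
    polynomialToPowerSeries K A c * f = f * polynomialToPowerSeries K A c := by
  ext n
  rw [PowerSeries.coeff_mul, PowerSeries.coeff_mul, ← Finset.Nat.sum_antidiagonal_swap]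
  refine Finset.sum_congr rfl fun p _ => ?_
  simp only [Prod.fst_swap, Prod.snd_swap, coeff_polynomialToPowerSeries]
  exact Algebra.commutes _ _

/-- The unit `1 + X a` of the power series ring. -/
noncomputable def PowerSeries.oneAddXMul {A : Type*} [Ring A] (a : A) : (PowerSeries A)ˣ where
  val := 1 + PowerSeries.X * PowerSeries.C a
  inv := PowerSeries.invOfUnit (1 + PowerSeries.X * PowerSeries.C a) 1
  val_inv := PowerSeries.mul_invOfUnit _ _ (by simp)
  inv_val := PowerSeries.invOfUnit_mul _ _ (by simp)

theorem sum_mul_lift_oneAddXMul_freeMonoid_eq_zero {K : Type*} [CommRing K]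
    (S : Finset (FreeGroup (Fin 2))) (c : FreeGroup (Fin 2) → Polynomial K)
    (h : ∑ g ∈ S, polynomialToPowerSeries K (MonoidAlgebra K (FreeMonoid (Fin 2))) (c g) *
      (FreeGroup.lift (fun b : Fin 2 =>
        PowerSeries.oneAddXMul (MonoidAlgebra.of K _ (FreeMonoid.of b))) g :
        (PowerSeries (MonoidAlgebra K (FreeMonoid (Fin 2))))ˣ) = 0) :
    ∀ g ∈ S, c g = 0 := by
  classical
  let _ : Algebra (Polynomial K) (PowerSeries (MonoidAlgebra K (FreeMonoid (Fin 2)))) :=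
    RingHom.toAlgebra' (polynomialToPowerSeries K (MonoidAlgebra K (FreeMonoid (Fin 2))))
      polynomialToPowerSeries_commutes
  have inj := injective_lift_freeGroup_of_one_add (C := Polynomial K)
    (X := fun b => PowerSeries.X * PowerSeries.C (MonoidAlgebra.of K _ (FreeMonoid.of b)))
    (u := fun b : Fin 2 => PowerSeries.oneAddXMul (MonoidAlgebra.of K _ (FreeMonoid.of b)))
    (fun b => rfl) (by
      intro b c r s h
      have key : ∀ n, algebraMap K (MonoidAlgebra K (FreeMonoid (Fin 2))) (c.coeff (n + 1)) +
          MonoidAlgebra.of K _ (FreeMonoid.of b) * PowerSeries.coeff n r +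
          MonoidAlgebra.of K _ (FreeMonoid.of (b + 1)) * PowerSeries.coeff n s = 0 := by
        intro n
        have := congrArg (PowerSeries.coeff (n + 1)) h
        rw [mul_assoc, mul_assoc, map_add, map_add, PowerSeries.coeff_succ_X_mul,
          PowerSeries.coeff_succ_X_mul, PowerSeries.coeff_C_mul, PowerSeries.coeff_C_mul] at this
        rw [← coeff_polynomialToPowerSeries]
        exact this
      have key0 : algebraMap K (MonoidAlgebra K (FreeMonoid (Fin 2))) (c.coeff 0) = 0 := by
        have := congrArg (PowerSeries.coeff 0) h
        rw [mul_assoc, mul_assoc, map_add, map_add, PowerSeries.coeff_zero_X_mul,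
          PowerSeries.coeff_zero_X_mul, add_zero, add_zero] at this
        rw [← coeff_polynomialToPowerSeries]
        exact this
      have key' := fun n => FreeMonoid.algebraMap_add_of_mul_add_of_mul_eq_zero b _ _ _ (key n)
      refine ⟨?_, ?_, ?_⟩
      · ext n
        cases n with
        | zero =>
          exact (FreeMonoid.algebraMap_add_of_mul_add_of_mul_eq_zero b _ 0 0 (by simp [key0])).1
        | succ n => exact (key' n).1
      · ext n : 1
        exact (key' n).2.1
      · ext n : 1
        exact (key' n).2.2)
  have h0 : ∑ g ∈ S, MonoidAlgebra.single g (c g) = 0 := by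
    refine inj ?_
    rw [map_zero, map_sum, ← h]
    refine Finset.sum_congr rfl fun g _ => ?_
    rw [MonoidAlgebra.lift_single, Algebra.smul_def]
    rfl
  intro g hg
  have h1 := congrArg (fun f => MonoidAlgebra.coeff f g) h0
  simpa [Finsupp.single_apply, hg] using h1

theorem sum_mul_lift_oneAddXMul_eq_zero {K A : Type*} [CommRing K] [Ring A] [Algebra K A]
    {α : MonoidAlgebra K (FreeMonoid (Fin 2)) →ₐ[K] A} (hα : Function.Injective α)
    (S : Finset (FreeGroup (Fin 2))) (c : FreeGroup (Fin 2) → Polynomial K)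
    (h : ∑ g ∈ S, polynomialToPowerSeries K A (c g) *
      (FreeGroup.lift (fun b : Fin 2 =>
        PowerSeries.oneAddXMul (α (MonoidAlgebra.of K _ (FreeMonoid.of b)))) g :
        (PowerSeries A)ˣ) = 0) :
    ∀ g ∈ S, c g = 0 := by
  refine sum_mul_lift_oneAddXMul_freeMonoid_eq_zero S c ?_
  have hinj : Function.Injective
      (PowerSeries.map (α : MonoidAlgebra K (FreeMonoid (Fin 2)) →+* A)) :=
    PowerSeries.map_injective _ hα
  have hlift : FreeGroup.lift (fun b : Fin 2 =>
      PowerSeries.oneAddXMul (α (MonoidAlgebra.of K _ (FreeMonoid.of b)))) =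
      (Units.map (PowerSeries.map (α : MonoidAlgebra K (FreeMonoid (Fin 2)) →+* A) :
        _ →* _)).comp (FreeGroup.lift (fun b : Fin 2 =>
        PowerSeries.oneAddXMul (MonoidAlgebra.of K _ (FreeMonoid.of b)))) := by
    ext b : 2
    simp [PowerSeries.oneAddXMul]
  refine hinj ?_
  rw [map_zero, map_sum, ← h]
  refine Finset.sum_congr rfl fun g _ => ?_
  rw [map_mul, hlift]
  congr 1
  ext n
  rw [PowerSeries.coeff_map, coeff_polynomialToPowerSeries, coeff_polynomialToPowerSeries,
    RingHom.coe_coe, α.commutes]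

universe u

open Polynomial in
/-- The right Ore condition in `D[X]` for a denominator of the form `1 + X x`. -/
theorem Polynomial.exists_mul_eq_one_add_X_mul_C_mul {D : Type*} [DivisionRing D] (x : D)
    (p : D[X]) : ∃ s ≠ 0, ∃ r, p * s = (1 + X * C x) * r := by
  by_cases hx : x = 0
  · exact ⟨1, one_ne_zero, p, by simp [hx]⟩
  set m : D[X] := X - C (-x⁻¹) with hm
  have hu : 1 + X * C x = m * C x := by
    rw [hm, sub_mul, ← C_mul]
    simp [hx, add_comm]
  have hmx : m = (1 + X * C x) * C x⁻¹ := by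
    rw [hu, mul_assoc, ← C_mul, mul_inv_cancel₀ hx, C_1, mul_one]
  have hmonic : m.Monic := monic_X_sub_C _
  obtain ⟨c, hc⟩ : ∃ c, p %ₘ m = C c := by
    refine ⟨_, eq_C_of_degree_le_zero ?_⟩
    have h := degree_modByMonic_lt p hmonic
    rw [hm, degree_X_sub_C] at h
    exact Nat.WithBot.lt_one_iff_le_zero.1 h
  have hp : p = C c + m * (p /ₘ m) := by rw [← hc, modByMonic_add_div]
  by_cases hc0 : c = 0
  · refine ⟨1, one_ne_zero, C x⁻¹ * (p /ₘ m), ?_⟩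
    rw [← mul_assoc, ← hmx, mul_one]
    simpa [hc0] using hp
  · refine ⟨X + C (c⁻¹ * x⁻¹ * c), (monic_X_add_C _).ne_zero,
      C x⁻¹ * (C c + p /ₘ m * (X + C (c⁻¹ * x⁻¹ * c))), ?_⟩
    rw [← mul_assoc (1 + X * C x), ← hmx, mul_add m, ← mul_assoc m]
    conv_lhs => rw [hp, add_mul]
    congr 1
    rw [mul_add, ← C_mul, hm, sub_mul, ← C_mul, ← X_mul_C]
    simp [mul_assoc, hc0]

open Polynomial in
theorem exists_lift_mul_map_mul_eq_map {D : Type u} [DivisionRing D] (x : Fin 2 → D)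
    (g : FreeGroup (Fin 2)) (p : D[X]) : ∃ s ≠ 0, ∃ r, ∀ (T : Type u) [Ring T] (φ : D[X] →+* T)
      (U : Fin 2 → Tˣ), (∀ b, (U b : T) = φ (1 + X * C (x b))) →
      ((FreeGroup.lift U g : Tˣ) : T) * φ (p * s) = φ r := by
  induction g using FreeGroup.induction_of_mul with
  | one => exact ⟨1, one_ne_zero, p, fun T _ φ U _ => by simp⟩
  | of_mul b g ih =>
    obtain ⟨s, hs, r, h⟩ := ih
    refine ⟨s, hs, (1 + X * C (x b)) * r, fun T _ φ U hU => ?_⟩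
    rw [map_mul, Units.val_mul, FreeGroup.lift_apply_of, mul_assoc, h T φ U hU, hU, map_mul φ]
  | inv_of_mul b g ih =>
    obtain ⟨s, hs, r, h⟩ := ih
    obtain ⟨s', hs', r', h'⟩ := exists_mul_eq_one_add_X_mul_C_mul (x b) r
    refine ⟨s * s', mul_ne_zero hs hs', r', fun T _ φ U hU => ?_⟩
    rw [map_mul, Units.val_mul, ← mul_assoc p, map_mul φ, mul_assoc,
      ← mul_assoc ((FreeGroup.lift U g : Tˣ) : T), h T φ U hU, ← map_mul, h', map_mul φ, ← hU,
      map_inv, FreeGroup.lift_apply_of, Units.inv_mul_cancel_left]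

open Polynomial in
theorem exists_forall_lift_mul_map_eq_map {D : Type u} [DivisionRing D] (x : Fin 2 → D)
    (S : Finset (FreeGroup (Fin 2))) : ∃ s ≠ 0, ∃ r : FreeGroup (Fin 2) → D[X],
      ∀ (T : Type u) [Ring T] (φ : D[X] →+* T) (U : Fin 2 → Tˣ),
      (∀ b, (U b : T) = φ (1 + X * C (x b))) →
      ∀ g ∈ S, ((FreeGroup.lift U g : Tˣ) : T) * φ s = φ (r g) := by
  classical
  induction S using Finset.induction_on with
  | empty => exact ⟨1, one_ne_zero, fun _ => 0, by simp⟩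
  | insert g S _ ih =>
    obtain ⟨s, hs, r, h⟩ := ih
    obtain ⟨s', hs', r', h'⟩ := exists_lift_mul_map_mul_eq_map x g s
    refine ⟨s * s', mul_ne_zero hs hs', fun g' => if g' = g then r' else r g' * s',
      fun T _ φ U hU g' hg' => ?_⟩
    by_cases hgg : g' = g
    · beta_reduce
      rw [if_pos hgg, hgg]
      exact h' T φ U hU
    · beta_reduce
      rw [if_neg hgg, map_mul, ← mul_assoc,
        h T φ U hU g' ((Finset.mem_insert.1 hg').resolve_left hgg), map_mul]

/-- Evaluation at a scalar of polynomials over a noncommutative algebra. -/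
noncomputable def Polynomial.evalAlgebraMap {K : Type*} (D : Type*) [CommRing K] [Ring D]
    [Algebra K D] (a : K) : Polynomial D →+* D :=
  Polynomial.eval₂RingHom' (RingHom.id D) (algebraMap K D a)
    fun d => (Algebra.commutes a d).symm

theorem Polynomial.evalAlgebraMap_X {K D : Type*} [CommRing K] [Ring D] [Algebra K D] (a : K) :
    evalAlgebraMap D a X = algebraMap K D a :=
  eval₂_X _ _

theorem Polynomial.evalAlgebraMap_C {K D : Type*} [CommRing K] [Ring D] [Algebra K D] (a : K)
    (d : D) : evalAlgebraMap D a (C d) = d :=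
  eval₂_C _ _

theorem Polynomial.evalAlgebraMap_map {K D : Type*} [CommRing K] [Ring D] [Algebra K D] (a : K)
    (c : Polynomial K) :
    evalAlgebraMap D a (c.map (algebraMap K D)) = algebraMap K D (c.eval a) := by
  change eval₂ (RingHom.id D) (algebraMap K D a) (c.map (algebraMap K D)) = _
  rw [eval₂_map, RingHom.id_comp, eval₂_at_apply]

theorem Polynomial.exists_eval_eq_dual_evalAlgebraMap {K D : Type*} [CommRing K] [Ring D]
    [Algebra K D] (l : Module.Dual K D) (p : Polynomial D) :
    ∃ q : Polynomial K, (∀ n, q.coeff n = l (p.coeff n)) ∧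
      ∀ a, q.eval a = l (evalAlgebraMap D a p) := by
  refine ⟨∑ i ∈ Finset.range (p.natDegree + 1), monomial i (l (p.coeff i)), fun n => ?_,
    fun a => ?_⟩
  · simp only [finsetSum_coeff, coeff_monomial, Finset.sum_ite_eq', Finset.mem_range]
    split_ifs with h
    · rfl
    · rw [coeff_eq_zero_of_natDegree_lt (by omega), map_zero]
  · change _ = l (eval₂ (RingHom.id D) (algebraMap K D a) p)
    rw [eval₂_eq_sum_range, eval_finsetSum, map_sum]
    refine Finset.sum_congr rfl fun i _ => ?_
    rw [eval_monomial, RingHom.id_apply, ← map_pow, ← Algebra.commutes, ← Algebra.smul_def,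
      map_smul, smul_eq_mul, mul_comm]

open Polynomial in
theorem Polynomial.finite_setOf_dependent_evalAlgebraMap {K D ι : Type*} [Field K] [Ring D]
    [Algebra K D] (S : Finset ι) (r : ι → D[X])
    (h : ∀ c : ι → K[X], ∑ i ∈ S, (c i).map (algebraMap K D) * r i = 0 → ∀ i ∈ S, c i = 0) :
    {a : K | ∃ d : ι → K, ∑ i ∈ S, d i • evalAlgebraMap D a (r i) = 0 ∧
      ∃ i ∈ S, d i ≠ 0}.Finite := by
  classical
  induction S using Finset.induction_on generalizing r with
  | empty => simp
  | insert j S hj ih =>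
    have hrj : r j ≠ 0 := by
      intro h0
      have := h (Pi.single j 1) (by
        refine Finset.sum_eq_zero fun i _ => ?_
        by_cases hij : i = j
        · rw [hij, h0, mul_zero]
        · simp [hij]) j (Finset.mem_insert_self _ _)
      simp at this
    obtain ⟨n, hn⟩ : ∃ n, (r j).coeff n ≠ 0 := by
      by_contra! hc
      exact hrj (Polynomial.ext fun n => by simp [hc n])
    obtain ⟨l, hl⟩ : ∃ l : Module.Dual K D, l ((r j).coeff n) ≠ 0 := by
      by_contra! hc
      exact hn ((Module.forall_dual_apply_eq_zero_iff K _).1 hc)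
    choose Λ hΛ hΛe using fun i => exists_eval_eq_dual_evalAlgebraMap l (r i)
    have hΛj : Λ j ≠ 0 := fun h0 => hl (by rw [← hΛ, h0, coeff_zero])
    have ih' := ih (fun i => (Λ j).map (algebraMap K D) * r i - (Λ i).map (algebraMap K D) * r j)
      (by
        intro c hc i hi
        have hne : ∀ i ∈ S, i ≠ j := fun i hi hij => hj (hij ▸ hi)
        have := h (fun i => if i = j then -∑ i ∈ S, c i * Λ i else c i * Λ j) (by
          rw [Finset.sum_insert hj, if_pos rfl, ← hc]
          have h1 : ∑ i ∈ S, (if i = j then -∑ i ∈ S, c i * Λ i else c i * Λ j).map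
              (algebraMap K D) * r i = ∑ i ∈ S, (c i * Λ j).map (algebraMap K D) * r i :=
            Finset.sum_congr rfl fun i hi => by rw [if_neg (hne i hi)]
          rw [h1]
          simp only [mul_sub, Finset.sum_sub_distrib, Polynomial.map_neg, Polynomial.map_sum,
            Polynomial.map_mul, neg_mul, Finset.sum_mul, mul_assoc]
          abel) i (Finset.mem_insert_of_mem hi)
        rw [if_neg (hne i hi)] at this
        exact (mul_eq_zero.1 this).resolve_right hΛj)
    refine (ih'.union (finite_setOfPred_isRoot hΛj)).subset ?_
    rintro a ⟨d, hd, hdne⟩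
    by_contra hcon
    simp only [Set.mem_union, Set.mem_ofPred_eq, not_or, not_exists, not_and, not_not,
      IsRoot.def] at hcon
    obtain ⟨hcon, hroot⟩ := hcon
    have hl0 := congrArg l hd
    rw [Finset.sum_insert hj] at hd hl0
    simp only [map_add, map_sum, map_smul, ← hΛe, map_zero, smul_eq_mul] at hl0
    have hS : ∀ i ∈ S, d i = 0 := by
      refine hcon d ?_
      simp only [map_sub, map_mul, evalAlgebraMap_map, ← Algebra.smul_def, smul_sub,
        Finset.sum_sub_distrib, smul_smul, ← Finset.sum_smul]
      rw [eq_neg_of_add_eq_zero_right hl0]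
      simp only [mul_comm (d _) ((Λ j).eval a), ← smul_smul, ← Finset.smul_sum]
      rw [eq_neg_of_add_eq_zero_right hd]
      module
    obtain ⟨i, hi, hdi⟩ := hdne
    rcases Finset.mem_insert.1 hi with rfl | hi
    · rw [Finset.sum_eq_zero (fun i hi => by rw [hS i hi, zero_mul]), add_zero] at hl0
      exact hdi ((mul_eq_zero.1 hl0).resolve_right hroot)
    · exact hdi (hS i hi)

open Polynomial in
theorem exists_injective_monoidAlgebra_freeGroup {K : Type*} {D : Type u} [Field K]
    [DivisionRing D] [Algebra K D] [Uncountable K]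
    (ψ : FreeAlgebra K (Fin 2) →ₐ[K] D) (hψ : Function.Injective ψ) :
    ∃ χ : MonoidAlgebra K (FreeGroup (Fin 2)) →ₐ[K] D, Function.Injective χ := by
  classical
  let α : MonoidAlgebra K (FreeMonoid (Fin 2)) →ₐ[K] D :=
    ψ.comp FreeAlgebra.equivMonoidAlgebraFreeMonoid.symm.toAlgHom
  have hα : Function.Injective α := hψ.comp FreeAlgebra.equivMonoidAlgebraFreeMonoid.symm.injective
  let x : Fin 2 → D := fun b => α (MonoidAlgebra.of K _ (FreeMonoid.of b))
  have hx : ∀ (a : K) b, 1 + algebraMap K D a * x b ≠ 0 := by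
    intro a b h
    have h1 : (1 : MonoidAlgebra K (FreeMonoid (Fin 2))) +
        algebraMap K _ a * MonoidAlgebra.of K _ (FreeMonoid.of b) = 0 :=
      hα (by rw [map_add, map_mul, map_one, AlgHom.commutes, map_zero, ← h])
    rw [Algebra.commutes] at h1
    exact one_ne_zero (FreeMonoid.algebraMap_add_of_mul_add_of_mul_eq_zero b (1 : K)
      (algebraMap K _ a) 0 (by rw [map_one, mul_zero, add_zero, h1])).1
  choose s hs r hr using exists_forall_lift_mul_map_eq_map x
  have hfin := fun S => finite_setOf_dependent_evalAlgebraMap (K := K) S (r S) (by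
    intro c hc
    refine sum_mul_lift_oneAddXMul_eq_zero hα S c ?_
    have hcoe : ((s S : D[X]) : PowerSeries D) ≠ 0 := by
      simpa using hs S
    refine (mul_eq_zero.1 ?_).resolve_right hcoe
    have h1 := congrArg (coeToPowerSeries.ringHom (R := D)) hc
    rw [map_zero, map_sum] at h1
    rw [Finset.sum_mul, ← h1]
    refine Finset.sum_congr rfl fun g hg => ?_
    rw [map_mul, ← hr S _ coeToPowerSeries.ringHom (fun b => PowerSeries.oneAddXMul (x b))
      (fun b => by simp [PowerSeries.oneAddXMul, PowerSeries.X_mul]) g hg, mul_assoc]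
    congr 1
    ext n
    simp [coeff_polynomialToPowerSeries])
  obtain ⟨a, ha⟩ : ∃ a, a ∉ ⋃ S, {a : K | ∃ d : FreeGroup (Fin 2) → K,
      ∑ g ∈ S, d g • evalAlgebraMap D a (r S g) = 0 ∧ ∃ g ∈ S, d g ≠ 0} := by
    by_contra! hc
    have : (Set.univ : Set K).Countable :=
      (Set.countable_iUnion fun S => (hfin S).countable).mono fun a _ => hc a
    exact not_countable (Set.countable_univ_iff.1 this)
  simp only [Set.mem_iUnion, Set.mem_ofPred_eq, not_exists, not_and, not_not] at ha
  let u : Fin 2 → Dˣ := fun b => Units.mk0 _ (hx a b)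
  refine ⟨MonoidAlgebra.lift K D _ ((Units.coeHom D).comp (FreeGroup.lift u)), ?_⟩
  rw [injective_iff_map_eq_zero]
  intro f hf
  rw [MonoidAlgebra.lift_apply] at hf
  have h0 := ha f.coeff.support f.coeff (by
    have h1 := congrArg (· * evalAlgebraMap D a (s f.coeff.support)) hf
    simp only [zero_mul, Finsupp.sum, Finset.sum_mul] at h1
    rw [← h1]
    refine Finset.sum_congr rfl fun g hg => ?_
    rw [← hr _ D (evalAlgebraMap D a) u (fun b => ?_) g hg, smul_mul_assoc]
    · rfl
    · rw [map_add, map_mul, map_one, evalAlgebraMap_X, evalAlgebraMap_C]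
      rfl)
  ext g
  by_contra hg
  exact hg (h0 g (Finsupp.mem_support_iff.2 hg))

theorem statement9 {D : Type*} [DivisionRing D]
    (huncount : Uncountable (Subring.center D))
    (hfree : ∃ ψ : FreeAlgebra (Subring.center D) (Fin 2) →ₐ[Subring.center D] D,
      Function.Injective ψ) :
    ∃ χ : MonoidAlgebra (Subring.center D) (FreeGroup (Fin 2))
        →ₐ[Subring.center D] D,
      Function.Injective χ := by
  obtain ⟨ψ, hψ⟩ := hfree
  exact exists_injective_monoidAlgebra_freeGroup ψ hψ
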